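/- Let n ≥ 2 and let f : ℝ³ → ℝ be a smooth function (ContDiff ℝ ⊤) that is polyharmonic of order n − 1, i.e. Δⁿ⁻¹f = 0 on ℝ³. Then the function g(x) = (x₁² + x₂² + x₃²) · f(x) is polyharmonic of order n, i.e. Δⁿg = 0 on ℝ³. -/

import Mathlib

/-- Partial derivative along the `i`-th coordinate direction in `ℝ³`. -/
noncomputable def pd (i : Fin 3) (f : (Fin 3 → ℝ) → ℝ) : (Fin 3 → ℝ) → ℝ :=
  fun x => fderiv ℝ f x (Pi.single i 1)

/-- Scalar Laplacian `Δf = ∂₁²f + ∂₂²f + ∂₃²f`. -/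
noncomputable def lap (f : (Fin 3 → ℝ) → ℝ) : (Fin 3 → ℝ) → ℝ :=
  fun x => pd 0 (pd 0 f) x + pd 1 (pd 1 f) x + pd 2 (pd 2 f) x

/-- Divergence of a vector field given by components. -/
noncomputable def div3 (F1 F2 F3 : (Fin 3 → ℝ) → ℝ) : (Fin 3 → ℝ) → ℝ :=
  fun x => pd 0 F1 x + pd 1 F2 x + pd 2 F3 x

/-- First component of the curl. -/
noncomputable def curl1 (F1 F2 F3 : (Fin 3 → ℝ) → ℝ) : (Fin 3 → ℝ) → ℝ :=
  fun x => pd 1 F3 x - pd 2 F2 x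

/-- Second component of the curl. -/
noncomputable def curl2 (F1 F2 F3 : (Fin 3 → ℝ) → ℝ) : (Fin 3 → ℝ) → ℝ :=
  fun x => pd 2 F1 x - pd 0 F3 x

/-- Third component of the curl. -/
noncomputable def curl3 (F1 F2 F3 : (Fin 3 → ℝ) → ℝ) : (Fin 3 → ℝ) → ℝ :=
  fun x => pd 0 F2 x - pd 1 F1 x

theorem ContDiff.pd {f : (Fin 3 → ℝ) → ℝ} (hf : ContDiff ℝ (⊤ : ℕ∞) f) (i : Fin 3) :
    ContDiff ℝ (⊤ : ℕ∞) (pd i f) :=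
  (hf.fderiv_right (by simp)).clm_apply contDiff_const

theorem ContDiff.lap {f : (Fin 3 → ℝ) → ℝ} (hf : ContDiff ℝ (⊤ : ℕ∞) f) :
    ContDiff ℝ (⊤ : ℕ∞) (lap f) :=
  (((hf.pd 0).pd 0).add ((hf.pd 1).pd 1)).add ((hf.pd 2).pd 2)

theorem ContDiff.lap_iterate {f : (Fin 3 → ℝ) → ℝ} (hf : ContDiff ℝ (⊤ : ℕ∞) f) (k : ℕ) :
    ContDiff ℝ (⊤ : ℕ∞) (_root_.lap^[k] f) := by
  induction k with
  | zero => exact hf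
  | succ k ih => rw [Function.iterate_succ_apply']; exact ih.lap

theorem pd_add {f g : (Fin 3 → ℝ) → ℝ} (hf : Differentiable ℝ f) (hg : Differentiable ℝ g)
    (i : Fin 3) : pd i (f + g) = pd i f + pd i g := by
  ext x
  simp [pd, fderiv_add (hf x) (hg x)]

theorem pd_smul (c : ℝ) (f : (Fin 3 → ℝ) → ℝ) (i : Fin 3) : pd i (c • f) = c • pd i f := by
  ext x
  simp [pd, fderiv_const_smul_field]

theorem pd_mul {f g : (Fin 3 → ℝ) → ℝ} (hf : Differentiable ℝ f) (hg : Differentiable ℝ g)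
    (i : Fin 3) : pd i (f * g) = f * pd i g + pd i f * g := by
  ext x
  simp [pd, fderiv_mul (hf x) (hg x), mul_comm]

theorem pd_coord (i j : Fin 3) :
    pd j (fun y => y i) = fun _ => (Pi.single j 1 : Fin 3 → ℝ) i := by
  ext x
  simp [pd, fderiv_apply]

theorem pd_comm {f : (Fin 3 → ℝ) → ℝ} (hf : ContDiff ℝ (⊤ : ℕ∞) f) (i j : Fin 3) :
    pd i (pd j f) = pd j (pd i f) := by
  have hd : Differentiable ℝ (fderiv ℝ f) :=
    (hf.fderiv_right (m := (⊤ : ℕ∞)) (by simp)).differentiable (by simp)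
  have key (i j : Fin 3) (x : Fin 3 → ℝ) :
      pd i (pd j f) x = fderiv ℝ (fderiv ℝ f) x (Pi.single i 1) (Pi.single j 1) := by
    unfold pd
    rw [fderiv_clm_apply (hd x) (differentiableAt_const _)]
    simp
  ext x
  rw [key, key]
  refine (hf.contDiffAt.isSymmSndFDerivAt ?_).eq _ _
  simp only [minSmoothness_of_isRCLikeNormedField]
  exact WithTop.coe_le_coe.2 (le_top : (2 : ℕ∞) ≤ ⊤)

theorem lap_eq (f : (Fin 3 → ℝ) → ℝ) :
    lap f = pd 0 (pd 0 f) + pd 1 (pd 1 f) + pd 2 (pd 2 f) := rfl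

theorem lap_add {f g : (Fin 3 → ℝ) → ℝ} (hf : ContDiff ℝ (⊤ : ℕ∞) f)
    (hg : ContDiff ℝ (⊤ : ℕ∞) g) : lap (f + g) = lap f + lap g := by
  have key (i : Fin 3) : pd i (pd i (f + g)) = pd i (pd i f) + pd i (pd i g) := by
    rw [pd_add (hf.differentiable (by simp)) (hg.differentiable (by simp)),
      pd_add ((hf.pd i).differentiable (by simp)) ((hg.pd i).differentiable (by simp))]
  simp only [lap_eq, key]
  ring

theorem lap_add_add {f g h : (Fin 3 → ℝ) → ℝ} (hf : ContDiff ℝ (⊤ : ℕ∞) f)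
    (hg : ContDiff ℝ (⊤ : ℕ∞) g) (hh : ContDiff ℝ (⊤ : ℕ∞) h) :
    lap (f + g + h) = lap f + lap g + lap h := by
  rw [lap_add (f := f + g) (hf.add hg) hh, lap_add hf hg]

theorem lap_smul (c : ℝ) (f : (Fin 3 → ℝ) → ℝ) : lap (c • f) = c • lap f := by
  simp only [lap_eq, pd_smul, smul_add]

theorem lap_pd {f : (Fin 3 → ℝ) → ℝ} (hf : ContDiff ℝ (⊤ : ℕ∞) f) (i : Fin 3) :
    lap (pd i f) = pd i (lap f) := by
  have hd (j : Fin 3) : Differentiable ℝ (pd j (pd j f)) :=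
    ((hf.pd j).pd j).differentiable (by simp)
  rw [lap_eq, lap_eq, pd_add ((hd 0).add (hd 1)) (hd 2), pd_add (hd 0) (hd 1)]
  simp only [pd_comm (hf.pd _) i, pd_comm hf i]

theorem contDiff_coord (i : Fin 3) :
    ContDiff ℝ (⊤ : ℕ∞) (fun y : Fin 3 → ℝ => y i) := contDiff_apply ℝ ℝ i

theorem lap_coord_mul {f : (Fin 3 → ℝ) → ℝ} (hf : ContDiff ℝ (⊤ : ℕ∞) f) (i : Fin 3) :
    lap ((fun y => y i) * f) = (fun y => y i) * lap f + (2 : ℝ) • pd i f := by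
  have hx : Differentiable ℝ (fun y : Fin 3 → ℝ => y i) :=
    (contDiff_coord i).differentiable (by simp)
  have key (j : Fin 3) : pd j (pd j ((fun y => y i) * f)) =
      (fun y => y i) * pd j (pd j f) + (2 * (Pi.single j 1 : Fin 3 → ℝ) i) • pd j f := by
    have hd := hf.differentiable (by simp)
    have hdj := (hf.pd j).differentiable (by simp)
    have hc : (fun _ => (Pi.single j 1 : Fin 3 → ℝ) i) * f =
        ((Pi.single j 1 : Fin 3 → ℝ) i) • f := rfl
    rw [pd_mul hx hd, pd_coord, hc,
      pd_add (hx.mul hdj) (hd.const_smul _), pd_mul hx hdj, pd_coord, pd_smul]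
    ext x
    simp only [Pi.add_apply, Pi.mul_apply, Pi.smul_apply, smul_eq_mul]
    ring
  simp only [lap_eq, key]
  ext x
  fin_cases i <;> simp <;> ring

/-- The Euler operator `f ↦ x₁ ∂₁f + x₂ ∂₂f + x₃ ∂₃f`. -/
noncomputable def euler (f : (Fin 3 → ℝ) → ℝ) : (Fin 3 → ℝ) → ℝ :=
  (fun y => y 0) * pd 0 f + (fun y => y 1) * pd 1 f + (fun y => y 2) * pd 2 f

theorem ContDiff.euler {f : (Fin 3 → ℝ) → ℝ} (hf : ContDiff ℝ (⊤ : ℕ∞) f) :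
    ContDiff ℝ (⊤ : ℕ∞) (euler f) :=
  (((contDiff_coord 0).mul (hf.pd 0)).add ((contDiff_coord 1).mul (hf.pd 1))).add
    ((contDiff_coord 2).mul (hf.pd 2))

theorem lap_euler {f : (Fin 3 → ℝ) → ℝ} (hf : ContDiff ℝ (⊤ : ℕ∞) f) :
    lap (euler f) = euler (lap f) + (2 : ℝ) • lap f := by
  have hc (i : Fin 3) : ContDiff ℝ (⊤ : ℕ∞) ((fun y => y i) * pd i f) :=
    (contDiff_coord i).mul (hf.pd i)
  rw [euler, lap_add_add (hc 0) (hc 1) (hc 2)]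
  simp only [lap_coord_mul (hf.pd _), lap_pd hf]
  ext x
  simp [euler, lap_eq f]
  ring

theorem lap_normsq_mul {f : (Fin 3 → ℝ) → ℝ} (hf : ContDiff ℝ (⊤ : ℕ∞) f) :
    lap (fun y => ((y 0) ^ 2 + (y 1) ^ 2 + (y 2) ^ 2) * f y) =
      (fun y => ((y 0) ^ 2 + (y 1) ^ 2 + (y 2) ^ 2) * lap f y) +
        (4 : ℝ) • euler f + (6 : ℝ) • f := by
  have hc (i : Fin 3) : ContDiff ℝ (⊤ : ℕ∞) ((fun y => y i) * f) := (contDiff_coord i).mul hf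
  have hcc (i : Fin 3) : ContDiff ℝ (⊤ : ℕ∞) ((fun y => y i) * ((fun y => y i) * f)) :=
    (contDiff_coord i).mul (hc i)
  have hsum : (fun y : Fin 3 → ℝ => ((y 0) ^ 2 + (y 1) ^ 2 + (y 2) ^ 2) * f y) =
      (fun y => y 0) * ((fun y => y 0) * f) + (fun y => y 1) * ((fun y => y 1) * f) +
        (fun y => y 2) * ((fun y => y 2) * f) := by
    ext y
    simp only [Pi.add_apply, Pi.mul_apply]
    ring
  rw [hsum, lap_add_add (hcc 0) (hcc 1) (hcc 2)]
  simp only [lap_coord_mul (hc _), lap_coord_mul hf,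
    pd_mul ((contDiff_coord _).differentiable (by simp)) (hf.differentiable (by simp)), pd_coord]
  ext x
  simp [euler]
  ring

theorem exists_lap_iterate_normsq_mul {f : (Fin 3 → ℝ) → ℝ} (hf : ContDiff ℝ (⊤ : ℕ∞) f)
    (k : ℕ) : ∃ a b : ℝ,
      lap^[k + 1] (fun y => ((y 0) ^ 2 + (y 1) ^ 2 + (y 2) ^ 2) * f y) =
        (fun y => ((y 0) ^ 2 + (y 1) ^ 2 + (y 2) ^ 2) * lap^[k + 1] f y) +
          a • euler (lap^[k] f) + b • lap^[k] f := by
  induction k with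
  | zero => exact ⟨4, 6, lap_normsq_mul hf⟩
  | succ k ih =>
    obtain ⟨a, b, h⟩ := ih
    refine ⟨a + 4, 2 * a + b + 6, ?_⟩
    have hk := hf.lap_iterate k
    have hk' := hf.lap_iterate (k + 1)
    have hr : ContDiff ℝ (⊤ : ℕ∞)
        (fun y : Fin 3 → ℝ => ((y 0) ^ 2 + (y 1) ^ 2 + (y 2) ^ 2) * lap^[k + 1] f y) :=
      ((((contDiff_coord 0).pow 2).add ((contDiff_coord 1).pow 2)).add
        ((contDiff_coord 2).pow 2)).mul hk'
    have hE : ContDiff ℝ (⊤ : ℕ∞) (a • euler (lap^[k] f)) := hk.euler.const_smul a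
    have hb : ContDiff ℝ (⊤ : ℕ∞) (b • lap^[k] f) := hk.const_smul b
    rw [Function.iterate_succ_apply', h, lap_add_add hr hE hb, lap_smul, lap_smul, lap_euler hk, lap_normsq_mul hk', ← Function.iterate_succ_apply' lap k,
      ← Function.iterate_succ_apply' lap (k + 1)]
    module

theorem polyharmonic_normsq_mul (f : (Fin 3 → ℝ) → ℝ) (hf : ContDiff ℝ (⊤ : ℕ∞) f)
    (n : ℕ) (hn : 2 ≤ n) (hpoly : ∀ x : Fin 3 → ℝ, lap^[n - 1] f x = 0) :
    ∀ x : Fin 3 → ℝ,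
      lap^[n] (fun y => ((y 0) ^ 2 + (y 1) ^ 2 + (y 2) ^ 2) * f y) x = 0 := by
  obtain ⟨k, rfl⟩ : ∃ k, n = k + 1 := ⟨n - 1, by omega⟩
  have h0 : lap^[k] f = 0 := funext hpoly
  have hpd (i : Fin 3) : pd i 0 = 0 := by simpa using pd_smul 0 0 i
  obtain ⟨a, b, h⟩ := exists_lap_iterate_normsq_mul hf k
  intro x
  rw [h, Function.iterate_succ_apply', h0]
  simp [euler, lap_eq, hpd]
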